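/- Let B be a finitely generated skew brace such that B/Soc(B) is finite. If the group (B,∘) is virtually abelian, then B is finitely presented as a skew brace. -/

import Mathlib

universe u v

/-- A skew (left) brace: two group structures `(B,+)` and `(B,∘)` on the same set,
sharing the same identity element `zero` (recall that in any skew brace `0 = 1`),
satisfying the skew left distributive law `a ∘ (b + c) = a ∘ b - a + a ∘ c`. -/
structure SkewBrace (B : Type u) where
  add : B → B → B
  zero : B
  neg : B → B
  mul : B → B → B
  inv : B → B
  add_assoc : ∀ a b c, add (add a b) c = add a (add b c)
  zero_add : ∀ a, add zero a = a
  add_zero : ∀ a, add a zero = a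
  neg_add : ∀ a, add (neg a) a = zero
  add_neg : ∀ a, add a (neg a) = zero
  mul_assoc : ∀ a b c, mul (mul a b) c = mul a (mul b c)
  zero_mul : ∀ a, mul zero a = a
  mul_zero : ∀ a, mul a zero = a
  inv_mul : ∀ a, mul (inv a) a = zero
  mul_inv : ∀ a, mul a (inv a) = zero
  compat : ∀ a b c, mul a (add b c) = add (add (mul a b) (neg a)) (mul a c)

namespace SkewBrace

variable {B C Q : Type u}

/-- `λ_a (b) = -a + a ∘ b`. -/
def lam (S : SkewBrace B) (a b : B) : B := S.add (S.neg a) (S.mul a b)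

/-- `a ∗ b = λ_a(b) - b = -a + a ∘ b - b`. -/
def star (S : SkewBrace B) (a b : B) : B := S.add (S.lam a b) (S.neg b)

/-- A sub-skew brace: a subset containing the identity and closed under both group
operations and both inverses. -/
def IsSub (S : SkewBrace B) (T : Set B) : Prop :=
  S.zero ∈ T ∧ (∀ a ∈ T, ∀ b ∈ T, S.add a b ∈ T) ∧ (∀ a ∈ T, S.neg a ∈ T) ∧
    (∀ a ∈ T, ∀ b ∈ T, S.mul a b ∈ T) ∧ (∀ a ∈ T, S.inv a ∈ T)

/-- The sub-skew brace generated by a subset. -/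
def subGen (S : SkewBrace B) (X : Set B) : Set B := ⋂₀ {T | S.IsSub T ∧ X ⊆ T}

/-- A skew brace is finitely generated if a finite subset generates it. -/
def FinitelyGenerated (S : SkewBrace B) : Prop := ∃ T : Finset B, S.subGen ↑T = Set.univ

/-- A subgroup of the additive group `(B,+)`. -/
def IsAddSubgroup (S : SkewBrace B) (T : Set B) : Prop :=
  S.zero ∈ T ∧ (∀ a ∈ T, ∀ b ∈ T, S.add a b ∈ T) ∧ ∀ a ∈ T, S.neg a ∈ T

/-- A subgroup of the multiplicative group `(B,∘)`. -/
def IsMulSubgroup (S : SkewBrace B) (T : Set B) : Prop :=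
  S.zero ∈ T ∧ (∀ a ∈ T, ∀ b ∈ T, S.mul a b ∈ T) ∧ ∀ a ∈ T, S.inv a ∈ T

/-- The additive subgroup generated by a subset. -/
def addClosure (S : SkewBrace B) (X : Set B) : Set B := ⋂₀ {T | S.IsAddSubgroup T ∧ X ⊆ T}

/-- The multiplicative subgroup generated by a subset. -/
def mulClosure (S : SkewBrace B) (X : Set B) : Set B := ⋂₀ {T | S.IsMulSubgroup T ∧ X ⊆ T}

/-- The group `(B,+)` is finitely generated. -/
def AddFG (S : SkewBrace B) : Prop := ∃ T : Finset B, S.addClosure ↑T = Set.univ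

/-- The group `(B,∘)` is finitely generated. -/
def MulFG (S : SkewBrace B) : Prop := ∃ T : Finset B, S.mulClosure ↑T = Set.univ

/-- An ideal of a skew brace: a subgroup of `(B,+)`, normal in `(B,+)` and in `(B,∘)`,
invariant under all the maps `λ_b`. -/
def IsIdeal (S : SkewBrace B) (I : Set B) : Prop :=
  S.IsAddSubgroup I ∧ (∀ b : B, ∀ a ∈ I, S.add (S.add b a) (S.neg b) ∈ I) ∧
    (∀ b : B, ∀ a ∈ I, S.mul (S.mul b a) (S.inv b) ∈ I) ∧
    ∀ b : B, ∀ a ∈ I, S.lam b a ∈ I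

/-- The ideal generated by a subset (the smallest ideal containing it). -/
def idealGen (S : SkewBrace B) (X : Set B) : Set B := ⋂₀ {I | S.IsIdeal I ∧ X ⊆ I}

/-- A homomorphism of skew braces. -/
def IsHom (S : SkewBrace B) (T : SkewBrace C) (f : B → C) : Prop :=
  (∀ a b, f (S.add a b) = T.add (f a) (f b)) ∧ ∀ a b, f (S.mul a b) = T.mul (f a) (f b)

/-- `SF` together with `ι : X → F` is the free skew brace on `X`: every map from `X`
to a skew brace extends uniquely to a homomorphism. -/
def IsFreeOn {F : Type u} {X : Type v} (SF : SkewBrace F) (ι : X → F) : Prop :=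
  ∀ (C : Type u) (SC : SkewBrace C) (f : X → C),
    ∃! g : F → C, IsHom SF SC g ∧ ∀ x, g (ι x) = f x

/-- A skew brace is finitely presented if it is the image of a free skew brace on a
finite set under a homomorphism whose kernel is generated, as an ideal, by finitely
many elements. -/
def FinitelyPresented (S : SkewBrace B) : Prop :=
  ∃ (F : Type u) (SF : SkewBrace F) (m : ℕ) (ι : Fin m → F) (θ : F → B),
    IsFreeOn SF ι ∧ IsHom SF S θ ∧ Function.Surjective θ ∧
      ∃ R : Finset F, {x | θ x = S.zero} = SF.idealGen ↑R

/-- `π : B → Q` realizes `Q` as the quotient skew brace `B/I`. -/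
def IsQuotientBy (S : SkewBrace B) (I : Set B) (SQ : SkewBrace Q) (π : B → Q) : Prop :=
  IsHom S SQ π ∧ Function.Surjective π ∧ {x | π x = SQ.zero} = I

/-- The group `(B,+)` is finitely presented (as an abstract group). -/
def AddFP (S : SkewBrace B) : Prop :=
  ∃ (m : ℕ) (f : FreeGroup (Fin m) → B),
    (∀ x y, f (x * y) = S.add (f x) (f y)) ∧ Function.Surjective f ∧
      ∃ R : Finset (FreeGroup (Fin m)),
        {x | f x = S.zero} = ↑(Subgroup.normalClosure (R : Set (FreeGroup (Fin m))))

/-- The group `(B,∘)` is finitely presented (as an abstract group). -/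
def MulFP (S : SkewBrace B) : Prop :=
  ∃ (m : ℕ) (f : FreeGroup (Fin m) → B),
    (∀ x y, f (x * y) = S.mul (f x) (f y)) ∧ Function.Surjective f ∧
      ∃ R : Finset (FreeGroup (Fin m)),
        {x | f x = S.zero} = ↑(Subgroup.normalClosure (R : Set (FreeGroup (Fin m))))

/-- The ascending chain condition on sub-skew braces. -/
def SubACC (S : SkewBrace B) : Prop :=
  ∀ f : ℕ → Set B, Monotone f → (∀ n, S.IsSub (f n)) → ∃ n, ∀ m, n ≤ m → f m = f n

/-- The ascending chain condition on subgroups of `(B,+)`. -/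
def AddACC (S : SkewBrace B) : Prop :=
  ∀ f : ℕ → Set B, Monotone f → (∀ n, S.IsAddSubgroup (f n)) → ∃ n, ∀ m, n ≤ m → f m = f n

/-- The socle `Soc(B) = Ker(λ) ∩ Z(B,+)`. -/
def soc (S : SkewBrace B) : Set B :=
  {x | (∀ b, S.lam x b = b) ∧ ∀ b, S.add x b = S.add b x}

/-- The centre of the additive group `(B,+)`. -/
def addCenter (S : SkewBrace B) : Set B := {x | ∀ b, S.add x b = S.add b x}

/-- The preimage in `B` of `Ann(B/I)` (for `I` an ideal): the set of `x` such that,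
modulo `I`, `λ_x = id`, `x` is central in `(B,+)` and `x` is central in `(B,∘)`. -/
def annStep (S : SkewBrace B) (I : Set B) : Set B :=
  {x | (∀ b, S.add (S.lam x b) (S.neg b) ∈ I) ∧
       (∀ b, S.add (S.add x b) (S.neg (S.add b x)) ∈ I) ∧
       ∀ b, S.mul (S.mul x b) (S.inv (S.mul b x)) ∈ I}

/-- The preimage in `B` of `Soc(B/I)` (for `I` an ideal). -/
def socStep (S : SkewBrace B) (I : Set B) : Set B :=
  {x | (∀ b, S.add (S.lam x b) (S.neg b) ∈ I) ∧
       ∀ b, S.add (S.add x b) (S.neg (S.add b x)) ∈ I}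

/-- The upper annihilator series `Ann_α(B)`, defined by transfinite recursion. -/
noncomputable def annSeries (S : SkewBrace B) (o : Ordinal.{v}) : Set B :=
  Ordinal.limitRecOn o {S.zero} (fun _ ih => S.annStep ih)
    fun _o _ ih => ⋃ β, ⋃ h : β < _o, ih β h

/-- The upper socle series `Soc_α(B)`, defined by transfinite recursion. -/
noncomputable def socSeries (S : SkewBrace B) (o : Ordinal.{v}) : Set B :=
  Ordinal.limitRecOn o {S.zero} (fun _ ih => S.socStep ih)
    fun _o _ ih => ⋃ β, ⋃ h : β < _o, ih β h

/-- The solution of the YBE associated with a skew brace: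
`r_B(a,b) = (λ_a(b), λ_a(b)⁻¹ ∘ a ∘ b)`. -/
def braceR (S : SkewBrace B) : B × B → B × B :=
  fun p => (S.lam p.1 p.2, S.mul (S.inv (S.lam p.1 p.2)) (S.mul p.1 p.2))

end SkewBrace

/-- The set-theoretic Yang–Baxter (braid) equation
`(r × id)(id × r)(r × id) = (id × r)(r × id)(id × r)`. -/
def ybe {X : Type u} (r : X × X → X × X) : Prop :=
  let r₁ : X × X × X → X × X × X := fun p =>
    ((r (p.1, p.2.1)).1, (r (p.1, p.2.1)).2, p.2.2)
  let r₂ : X × X × X → X × X × X := fun p => (p.1, r p.2)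
  r₁ ∘ r₂ ∘ r₁ = r₂ ∘ r₁ ∘ r₂

/-- A non-degenerate set-theoretic solution: `r` is bijective, satisfies the YBE, and
writing `r (x,y) = (σ_x y, τ_y x)`, all maps `σ_x` and `τ_y` are bijective. -/
def IsNonDegenerateSolution {X : Type u} (r : X × X → X × X) : Prop :=
  Function.Bijective r ∧ ybe r ∧
    (∀ x, Function.Bijective fun y => (r (x, y)).1) ∧
    ∀ y, Function.Bijective fun x => (r (x, y)).2

/-- `S` (with the distinguished map `ι : X → B`) is the structure skew brace of the
solution `(X,r)`: the multiplicative group of `S` is the structure group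
`G(X,r) = ⟨X | x y = σ_x(y) τ_y(x)⟩` (expressed by the relations holding together
with the universal property of the presentation) and `r_S ∘ (ι × ι) = (ι × ι) ∘ r`. -/
def IsStructureSkewBrace {X B : Type u} (r : X × X → X × X)
    (S : SkewBrace B) (ι : X → B) : Prop :=
  (∀ x y, S.mul (ι x) (ι y) = S.mul (ι (r (x, y)).1) (ι (r (x, y)).2)) ∧
  (∀ (H : Type u) [Group H] (f : X → H),
      (∀ x y, f x * f y = f (r (x, y)).1 * f (r (x, y)).2) →
      ∃! φ : B → H, (∀ a b, φ (S.mul a b) = φ a * φ b) ∧ ∀ x, φ (ι x) = f x) ∧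
  ∀ x y, S.braceR (ι x, ι y) = (ι (r (x, y)).1, ι (r (x, y)).2)

namespace SkewBrace

section Basic

variable {B C : Type u} (S : SkewBrace B) {SC : SkewBrace C}

/-- The additive group of a skew brace. -/
abbrev addGroup : AddGroup B :=
  letI : Add B := ⟨S.add⟩
  letI : Zero B := ⟨S.zero⟩
  letI : Neg B := ⟨S.neg⟩
  AddGroup.ofLeftAxioms S.add_assoc S.zero_add S.neg_add

/-- The multiplicative group of a skew brace. -/
abbrev mulGroup : Group B :=
  letI : Mul B := ⟨S.mul⟩
  letI : One B := ⟨S.zero⟩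
  letI : Inv B := ⟨S.inv⟩
  Group.ofLeftAxioms S.mul_assoc S.zero_mul S.inv_mul

theorem neg_add_cancel_left (a b : B) : S.add (S.neg a) (S.add a b) = b := by
  rw [← S.add_assoc, S.neg_add, S.zero_add]

theorem add_neg_cancel_left (a b : B) : S.add a (S.add (S.neg a) b) = b := by
  rw [← S.add_assoc, S.add_neg, S.zero_add]

theorem add_left_cancel {a b c : B} (h : S.add a b = S.add a c) : b = c := by
  rw [← S.neg_add_cancel_left a b, h, S.neg_add_cancel_left]

theorem eq_of_neg_add_eq_zero {a b : B} (h : S.add (S.neg b) a = S.zero) : a = b := by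
  rw [← S.add_neg_cancel_left b a, h, S.add_zero]

theorem neg_add_rev (a b : B) : S.neg (S.add a b) = S.add (S.neg b) (S.neg a) :=
  letI := S.addGroup
  _root_.neg_add_rev a b

theorem neg_neg (a : B) : S.neg (S.neg a) = a :=
  letI := S.addGroup
  _root_.neg_neg a

theorem neg_eq_of_add_eq_zero {a b : B} (h : S.add a b = S.zero) : S.neg a = b :=
  letI := S.addGroup
  neg_eq_of_add_eq_zero_right (a := a) (b := b) h

theorem inv_eq_of_mul_eq_zero {a b : B} (h : S.mul a b = S.zero) : S.inv a = b :=
  letI := S.mulGroup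
  inv_eq_of_mul_eq_one_right (a := a) (b := b) h

theorem inv_inv (a : B) : S.inv (S.inv a) = a := S.inv_eq_of_mul_eq_zero (S.inv_mul a)

theorem mul_inv_cancel_left (a b : B) : S.mul a (S.mul (S.inv a) b) = b := by
  rw [← S.mul_assoc, S.mul_inv, S.zero_mul]

theorem inv_mul_rev (a b : B) : S.inv (S.mul a b) = S.mul (S.inv b) (S.inv a) :=
  letI := S.mulGroup
  mul_inv_rev a b

theorem mul_eq_add_lam (a b : B) : S.mul a b = S.add a (S.lam a b) :=
  (S.add_neg_cancel_left a _).symm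

theorem mul_add_eq (a b c : B) : S.mul a (S.add b c) = S.add (S.mul a b) (S.lam a c) := by
  rw [S.compat, S.add_assoc]; rfl

theorem lam_add (a b c : B) : S.lam a (S.add b c) = S.add (S.lam a b) (S.lam a c) := by
  rw [lam, S.mul_add_eq, ← S.add_assoc]; rfl

theorem lam_mul (a b c : B) : S.lam (S.mul a b) c = S.lam a (S.lam b c) := by
  rw [lam, S.mul_assoc, S.mul_eq_add_lam b c, S.mul_add_eq, S.neg_add_cancel_left]

theorem zero_lam (a : B) : S.lam S.zero a = a := by
  apply S.add_left_cancel (a := S.zero)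
  rw [← S.mul_eq_add_lam, S.zero_mul, S.zero_add]

theorem lam_zero (a : B) : S.lam a S.zero = S.zero := by
  rw [lam, S.mul_zero, S.neg_add]

theorem lam_neg (a b : B) : S.lam a (S.neg b) = S.neg (S.lam a b) := by
  symm
  apply S.neg_eq_of_add_eq_zero
  rw [← S.lam_add, S.add_neg, S.lam_zero]

theorem lam_inv_lam (a b : B) : S.lam a (S.lam (S.inv a) b) = b := by
  rw [← S.lam_mul, S.mul_inv, S.zero_lam]

theorem inv_lam_lam (a b : B) : S.lam (S.inv a) (S.lam a b) = b := by
  rw [← S.lam_mul, S.inv_mul, S.zero_lam]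

variable {S}

theorem IsHom.map_zero {f : B → C} (hf : IsHom S SC f) : f S.zero = SC.zero := by
  apply SC.add_left_cancel (a := f S.zero)
  rw [← hf.1, S.add_zero, SC.add_zero]

theorem IsHom.map_neg {f : B → C} (hf : IsHom S SC f) (a : B) :
    f (S.neg a) = SC.neg (f a) := by
  symm
  apply SC.neg_eq_of_add_eq_zero
  rw [← hf.1, S.add_neg, hf.map_zero]

theorem IsHom.map_inv {f : B → C} (hf : IsHom S SC f) (a : B) :
    f (S.inv a) = SC.inv (f a) := by
  symm
  apply SC.inv_eq_of_mul_eq_zero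
  rw [← hf.2, S.mul_inv, hf.map_zero]

theorem IsHom.map_lam {f : B → C} (hf : IsHom S SC f) (a b : B) :
    f (S.lam a b) = SC.lam (f a) (f b) := by
  rw [lam, hf.1, hf.map_neg, hf.2]; rfl

theorem IsHom.isIdeal_ker {f : B → C} (hf : IsHom S SC f) :
    S.IsIdeal {x | f x = SC.zero} := by
  refine ⟨⟨hf.map_zero, fun a ha b hb => ?_, fun a ha => ?_⟩, fun b a ha => ?_,
    fun b a ha => ?_, fun b a ha => ?_⟩ <;> simp only [Set.mem_ofPred_eq] at *
  · rw [hf.1, ha, hb, SC.add_zero]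
  · rw [hf.map_neg, ha, SC.neg_eq_of_add_eq_zero (SC.zero_add _)]
  · rw [hf.1, hf.1, ha, hf.map_neg, SC.add_zero, SC.add_neg]
  · rw [hf.2, hf.2, ha, hf.map_inv, SC.mul_zero, SC.mul_inv]
  · rw [hf.map_lam, ha, SC.lam_zero]

theorem isIdeal_idealGen (X : Set B) : S.IsIdeal (S.idealGen X) := by
  refine ⟨⟨fun I hI => hI.1.1.1, fun a ha b hb I hI => ?_, fun a ha I hI => ?_⟩,
    fun b a ha I hI => ?_, fun b a ha I hI => ?_, fun b a ha I hI => ?_⟩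
  · exact hI.1.1.2.1 a (ha I hI) b (hb I hI)
  · exact hI.1.1.2.2 a (ha I hI)
  · exact hI.1.2.1 b a (ha I hI)
  · exact hI.1.2.2.1 b a (ha I hI)
  · exact hI.1.2.2.2 b a (ha I hI)

theorem subset_idealGen (X : Set B) : X ⊆ S.idealGen X :=
  Set.subset_sInter fun _ h => h.2

theorem idealGen_subset {X I : Set B} (hI : S.IsIdeal I) (h : X ⊆ I) : S.idealGen X ⊆ I :=
  Set.sInter_subset_of_mem ⟨hI, h⟩

theorem isAddSubgroup_addClosure (X : Set B) : S.IsAddSubgroup (S.addClosure X) :=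
  ⟨fun _ h => h.1.1, fun a ha b hb I hI => hI.1.2.1 a (ha I hI) b (hb I hI),
    fun a ha I hI => hI.1.2.2 a (ha I hI)⟩

theorem subset_addClosure (X : Set B) : X ⊆ S.addClosure X :=
  Set.subset_sInter fun _ h => h.2

theorem addClosure_subset {X I : Set B} (hI : S.IsAddSubgroup I) (h : X ⊆ I) :
    S.addClosure X ⊆ I :=
  Set.sInter_subset_of_mem ⟨hI, h⟩

theorem IsAddSubgroup.image {f : B → C} (hf : IsHom S SC f) {I : Set B}
    (hI : S.IsAddSubgroup I) : SC.IsAddSubgroup (f '' I) := by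
  refine ⟨⟨_, hI.1, hf.map_zero⟩, ?_, ?_⟩
  · rintro _ ⟨a, ha, rfl⟩ _ ⟨b, hb, rfl⟩
    exact ⟨_, hI.2.1 a ha b hb, hf.1 a b⟩
  · rintro _ ⟨a, ha, rfl⟩
    exact ⟨_, hI.2.2 a ha, hf.map_neg a⟩

theorem IsAddSubgroup.preimage {f : B → C} (hf : IsHom S SC f) {I : Set C}
    (hI : SC.IsAddSubgroup I) : S.IsAddSubgroup (f ⁻¹' I) := by
  refine ⟨?_, fun a ha b hb => ?_, fun a ha => ?_⟩
  · rw [Set.mem_preimage, hf.map_zero]; exact hI.1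
  · rw [Set.mem_preimage, hf.1]; exact hI.2.1 _ ha _ hb
  · rw [Set.mem_preimage, hf.map_neg]; exact hI.2.2 _ ha

theorem image_addClosure {f : B → C} (hf : IsHom S SC f) (X : Set B) :
    f '' S.addClosure X = SC.addClosure (f '' X) := by
  apply Set.Subset.antisymm
  · rw [Set.image_subset_iff]
    exact addClosure_subset ((isAddSubgroup_addClosure _).preimage hf)
      (Set.image_subset_iff.1 (subset_addClosure _))
  · exact addClosure_subset ((isAddSubgroup_addClosure _).image hf)
      (Set.image_mono (subset_addClosure _))

end Basic

section Quotient

variable {B : Type u} {S : SkewBrace B} {I : Set B}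

theorem IsIdeal.mul_left_congr (hI : S.IsIdeal I) (a : B) {b b' : B}
    (h : S.add (S.neg b') b ∈ I) : S.add (S.neg (S.mul a b')) (S.mul a b) ∈ I := by
  have := hI.2.2.2 a _ h
  rw [← S.add_neg_cancel_left b' b, S.mul_add_eq, S.neg_add_cancel_left]
  exact this

theorem IsIdeal.mul_right_congr (hI : S.IsIdeal I) {a a' : B} (b : B)
    (h : S.add (S.neg a') a ∈ I) : S.add (S.neg (S.mul a' b)) (S.mul a b) ∈ I := by
  set j := S.lam (S.inv a') (S.add (S.neg a') a) with hj
  have hjI : j ∈ I := hI.2.2.2 _ _ h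
  have ha : a = S.mul a' j := by
    rw [S.mul_eq_add_lam, hj, S.lam_inv_lam, S.add_neg_cancel_left]
  have hab : S.mul a b = S.mul (S.mul a' b) (S.mul (S.mul (S.inv b) j) b) := by
    rw [ha, S.mul_assoc, S.mul_assoc, S.mul_assoc (S.inv b), S.mul_inv_cancel_left]
  have hk : S.mul (S.mul (S.inv b) j) b ∈ I := by
    have := hI.2.2.1 (S.inv b) j hjI
    rwa [S.inv_inv] at this
  rw [hab, S.mul_eq_add_lam (S.mul a' b), S.neg_add_cancel_left]
  exact hI.2.2.2 _ _ hk

theorem IsIdeal.add_left_congr (a : B) {b b' : B}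
    (h : S.add (S.neg b') b ∈ I) : S.add (S.neg (S.add a b')) (S.add a b) ∈ I := by
  rwa [S.neg_add_rev, S.add_assoc, S.neg_add_cancel_left]

theorem IsIdeal.add_right_congr (hI : S.IsIdeal I) {a a' : B} (b : B)
    (h : S.add (S.neg a') a ∈ I) : S.add (S.neg (S.add a' b)) (S.add a b) ∈ I := by
  have := hI.2.1 (S.neg b) _ h
  rw [S.neg_neg] at this
  rw [S.neg_add_rev]
  simpa only [S.add_assoc] using this

/-- Congruence modulo an ideal. -/
def IsIdeal.setoid (hI : S.IsIdeal I) : Setoid B where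
  r a b := S.add (S.neg b) a ∈ I
  iseqv :=
    { refl := fun a => by rw [S.neg_add]; exact hI.1.1
      symm := fun {a b} h => by
        have := hI.1.2.2 _ h
        rwa [S.neg_add_rev, S.neg_neg] at this
      trans := fun {a b c} h h' => by
        have := hI.1.2.1 _ h' _ h
        rwa [S.add_assoc, S.add_neg_cancel_left] at this }

theorem IsIdeal.exists_quotient (hI : S.IsIdeal I) :
    ∃ (Q : Type u) (SQ : SkewBrace Q) (q : B → Q), IsHom S SQ q ∧ Function.Surjective q ∧
      ∀ a b, q a = q b ↔ S.add (S.neg b) a ∈ I := by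
  let := hI.setoid
  have hadd : ∀ a a' : B, a ≈ a' → ∀ b b' : B, b ≈ b' → S.add a b ≈ S.add a' b' :=
    fun a a' h b b' h' =>
      Setoid.trans (hI.add_right_congr (a := a) (a' := a') b h)
        (IsIdeal.add_left_congr (b := b) (b' := b') a' h')
  have hmul : ∀ a a' : B, a ≈ a' → ∀ b b' : B, b ≈ b' → S.mul a b ≈ S.mul a' b' :=
    fun a a' h b b' h' =>
      Setoid.trans (hI.mul_right_congr (a := a) (a' := a') b h)
        (hI.mul_left_congr (b := b) (b' := b') a' h')
  have hneg : ∀ a a' : B, a ≈ a' → S.neg a ≈ S.neg a' := fun a a' h => by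
    have := hadd _ _ (hadd _ _ (Setoid.refl (S.neg a)) _ _ (Setoid.symm h)) _ _
      (Setoid.refl (S.neg a'))
    rw [S.neg_add, S.zero_add, S.add_assoc, S.add_neg, S.add_zero] at this
    exact this
  have hinv : ∀ a a' : B, a ≈ a' → S.inv a ≈ S.inv a' := fun a a' h => by
    have := hmul _ _ (hmul _ _ (Setoid.refl (S.inv a)) _ _ (Setoid.symm h)) _ _
      (Setoid.refl (S.inv a'))
    rw [S.inv_mul, S.zero_mul, S.mul_assoc, S.mul_inv, S.mul_zero] at this
    exact this
  let SQ : SkewBrace (Quotient hI.setoid) :=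
    { add := Quotient.map₂ S.add fun {a a'} h {b b'} h' => hadd a a' h b b' h'
      zero := ⟦S.zero⟧
      neg := Quotient.map S.neg fun {a a'} h => hneg a a' h
      mul := Quotient.map₂ S.mul fun {a a'} h {b b'} h' => hmul a a' h b b' h'
      inv := Quotient.map S.inv fun {a a'} h => hinv a a' h
      add_assoc := by
        rintro ⟨a⟩ ⟨b⟩ ⟨c⟩; exact congrArg (Quotient.mk _) (S.add_assoc a b c)
      zero_add := by rintro ⟨a⟩; exact congrArg (Quotient.mk _) (S.zero_add a)
      add_zero := by rintro ⟨a⟩; exact congrArg (Quotient.mk _) (S.add_zero a)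
      neg_add := by rintro ⟨a⟩; exact congrArg (Quotient.mk _) (S.neg_add a)
      add_neg := by rintro ⟨a⟩; exact congrArg (Quotient.mk _) (S.add_neg a)
      mul_assoc := by
        rintro ⟨a⟩ ⟨b⟩ ⟨c⟩; exact congrArg (Quotient.mk _) (S.mul_assoc a b c)
      zero_mul := by rintro ⟨a⟩; exact congrArg (Quotient.mk _) (S.zero_mul a)
      mul_zero := by rintro ⟨a⟩; exact congrArg (Quotient.mk _) (S.mul_zero a)
      inv_mul := by rintro ⟨a⟩; exact congrArg (Quotient.mk _) (S.inv_mul a)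
      mul_inv := by rintro ⟨a⟩; exact congrArg (Quotient.mk _) (S.mul_inv a)
      compat := by
        rintro ⟨a⟩ ⟨b⟩ ⟨c⟩; exact congrArg (Quotient.mk _) (S.compat a b c) }
  exact ⟨_, SQ, Quotient.mk _, ⟨fun _ _ => rfl, fun _ _ => rfl⟩, Quotient.mk_surjective,
    fun a b => Quotient.eq⟩

end Quotient

section Free

/-- Terms in the language of skew braces on variables indexed by `Fin m`. -/
inductive FreeTerm (m : ℕ) : Type u
  | var : Fin m → FreeTerm m
  | zero : FreeTerm m
  | add : FreeTerm m → FreeTerm m → FreeTerm m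
  | neg : FreeTerm m → FreeTerm m
  | mul : FreeTerm m → FreeTerm m → FreeTerm m
  | inv : FreeTerm m → FreeTerm m

/-- Evaluation of a term in a skew brace. -/
def FreeTerm.eval {m : ℕ} {C : Type u} (SC : SkewBrace C) (f : Fin m → C) :
    FreeTerm.{u} m → C
  | var i => f i
  | zero => SC.zero
  | add s t => SC.add (s.eval SC f) (t.eval SC f)
  | neg s => SC.neg (s.eval SC f)
  | mul s t => SC.mul (s.eval SC f) (t.eval SC f)
  | inv s => SC.inv (s.eval SC f)

/-- Two terms are identified when they agree under every evaluation in a skew brace. -/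
def freeSetoid (m : ℕ) : Setoid (FreeTerm.{u} m) where
  r s t := ∀ (C : Type u) (SC : SkewBrace C) (f : Fin m → C), s.eval SC f = t.eval SC f
  iseqv := ⟨fun _ _ _ _ => rfl, fun h C SC f => (h C SC f).symm,
    fun hst htr C SC f => (hst C SC f).trans (htr C SC f)⟩

/-- The free skew brace on `Fin m`. -/
def free (m : ℕ) : SkewBrace (Quotient (freeSetoid.{u} m)) where
  add := Quotient.map₂ FreeTerm.add fun _ _ h _ _ h' C SC f => by
    simp only [FreeTerm.eval, h C SC f, h' C SC f]
  zero := Quotient.mk _ FreeTerm.zero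
  neg := Quotient.map FreeTerm.neg fun _ _ h C SC f => by
    simp only [FreeTerm.eval, h C SC f]
  mul := Quotient.map₂ FreeTerm.mul fun _ _ h _ _ h' C SC f => by
    simp only [FreeTerm.eval, h C SC f, h' C SC f]
  inv := Quotient.map FreeTerm.inv fun _ _ h C SC f => by
    simp only [FreeTerm.eval, h C SC f]
  add_assoc := by
    rintro ⟨a⟩ ⟨b⟩ ⟨c⟩; exact Quotient.sound fun C SC f => SC.add_assoc _ _ _
  zero_add := by rintro ⟨a⟩; exact Quotient.sound fun C SC f => SC.zero_add _
  add_zero := by rintro ⟨a⟩; exact Quotient.sound fun C SC f => SC.add_zero _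
  neg_add := by rintro ⟨a⟩; exact Quotient.sound fun C SC f => SC.neg_add _
  add_neg := by rintro ⟨a⟩; exact Quotient.sound fun C SC f => SC.add_neg _
  mul_assoc := by
    rintro ⟨a⟩ ⟨b⟩ ⟨c⟩; exact Quotient.sound fun C SC f => SC.mul_assoc _ _ _
  zero_mul := by rintro ⟨a⟩; exact Quotient.sound fun C SC f => SC.zero_mul _
  mul_zero := by rintro ⟨a⟩; exact Quotient.sound fun C SC f => SC.mul_zero _
  inv_mul := by rintro ⟨a⟩; exact Quotient.sound fun C SC f => SC.inv_mul _
  mul_inv := by rintro ⟨a⟩; exact Quotient.sound fun C SC f => SC.mul_inv _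
  compat := by
    rintro ⟨a⟩ ⟨b⟩ ⟨c⟩; exact Quotient.sound fun C SC f => SC.compat _ _ _

/-- The canonical generators of the free skew brace. -/
def freeVar {m : ℕ} (i : Fin m) : Quotient (freeSetoid.{u} m) := Quotient.mk _ (FreeTerm.var i)

theorem isFreeOn_free (m : ℕ) : IsFreeOn (free.{u} m) freeVar := by
  intro C SC f
  refine ⟨Quotient.lift (FreeTerm.eval SC f) fun _ _ h => h C SC f,
    ⟨⟨?_, ?_⟩, fun _ => rfl⟩, ?_⟩
  · rintro ⟨a⟩ ⟨b⟩; rfl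
  · rintro ⟨a⟩ ⟨b⟩; rfl
  · rintro g ⟨hg, hgf⟩
    funext x
    induction x using Quotient.inductionOn with
    | h t =>
      induction t with
      | var i => exact hgf i
      | zero => exact hg.map_zero
      | add s t hs ht =>
        exact (hg.1 (Quotient.mk _ s) (Quotient.mk _ t)).trans (by rw [hs, ht]; rfl)
      | neg s hs => exact (hg.map_neg (Quotient.mk _ s)).trans (by rw [hs]; rfl)
      | mul s t hs ht =>
        exact (hg.2 (Quotient.mk _ s) (Quotient.mk _ t)).trans (by rw [hs, ht]; rfl)
      | inv s hs => exact (hg.map_inv (Quotient.mk _ s)).trans (by rw [hs]; rfl)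

/-- A homomorphism out of the free skew brace has image in every sub-skew brace containing
the images of the generators. -/
theorem map_free_mem {m : ℕ} {C : Type u} {SC : SkewBrace C}
    {g : Quotient (freeSetoid.{u} m) → C} (hg : IsHom (free m) SC g) {P : Set C}
    (hP : SC.IsSub P) (h : ∀ i, g (freeVar i) ∈ P) (x : Quotient (freeSetoid.{u} m)) :
    g x ∈ P := by
  obtain ⟨h0, hadd, hneg, hmul, hinv⟩ := hP
  induction x using Quotient.inductionOn with
  | h t =>
    induction t with
    | var i => exact h i
    | zero => exact hg.map_zero.symm ▸ h0
    | add s t hs ht => exact (hg.1 (Quotient.mk _ s) (Quotient.mk _ t)).symm ▸ hadd _ hs _ ht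
    | neg s hs => exact (hg.map_neg (Quotient.mk _ s)).symm ▸ hneg _ hs
    | mul s t hs ht => exact (hg.2 (Quotient.mk _ s) (Quotient.mk _ t)).symm ▸ hmul _ hs _ ht
    | inv s hs => exact (hg.map_inv (Quotient.mk _ s)).symm ▸ hinv _ hs

end Free

section Commuting

variable {B : Type u} {S : SkewBrace B}

/-- If the elements of `Y` act trivially on `T ∪ Y`, both by additive conjugation and through
`λ`, and `T` is closed under the operations up to elements of `Y`, then `T + Y` is a sub-skew
brace. -/
theorem isSub_image2_add {T Y : Set B} (hY : S.IsAddSubgroup Y)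
    (hc : ∀ y ∈ Y, ∀ u ∈ T ∪ Y, S.add y u = S.add u y ∧ S.lam y u = u)
    (hlam : ∀ t ∈ T, ∀ y ∈ Y, S.lam t y ∈ Y) (h0 : S.zero ∈ T)
    (hadd : ∀ t ∈ T, ∀ s ∈ T, S.add t s ∈ Set.image2 S.add T Y)
    (hneg : ∀ t ∈ T, S.neg t ∈ Set.image2 S.add T Y)
    (hmul : ∀ t ∈ T, ∀ s ∈ T, S.mul t s ∈ Set.image2 S.add T Y)
    (hinv : ∀ t ∈ T, S.inv t ∈ Set.image2 S.add T Y) :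
    S.IsSub (Set.image2 S.add T Y) := by
  have hcT : ∀ y ∈ Y, ∀ t ∈ T, S.add t y = S.add y t := fun y hy t ht =>
    (hc y hy t (Or.inl ht)).1.symm
  have add_mem : ∀ x ∈ Set.image2 S.add T Y, ∀ y ∈ Y, S.add x y ∈ Set.image2 S.add T Y := by
    rintro _ ⟨t, ht, y, hy, rfl⟩ y' hy'
    rw [S.add_assoc]
    exact ⟨t, ht, _, hY.2.1 _ hy _ hy', rfl⟩
  have swap : ∀ y ∈ Y, ∀ x ∈ Set.image2 S.add T Y, S.add y x = S.add x y := by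
    rintro y hy _ ⟨t, ht, y', hy', rfl⟩
    rw [← S.add_assoc, ← hcT y hy t ht, S.add_assoc, S.add_assoc, (hc y hy y' (Or.inr hy')).1]
  have fixed : ∀ y ∈ Y, ∀ x ∈ Set.image2 S.add T Y, S.lam y x = x := by
    rintro y hy _ ⟨t, ht, y', hy', rfl⟩
    rw [S.lam_add, (hc y hy t (Or.inl ht)).2, (hc y hy y' (Or.inr hy')).2]
  have eq_mul : ∀ t ∈ T, ∀ y ∈ Y, S.add t y = S.mul y t := fun t ht y hy => by
    rw [S.mul_eq_add_lam, (hc y hy t (Or.inl ht)).2, hcT y hy t ht]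
  have mul_mem : ∀ x ∈ Set.image2 S.add T Y, ∀ z ∈ Set.image2 S.add T Y,
      S.mul x z ∈ Set.image2 S.add T Y := by
    rintro _ ⟨t, ht, y, hy, rfl⟩ _ ⟨s, hs, y', hy', rfl⟩
    have h1 := add_mem _ (hmul t ht s hs) _ (hlam t ht y' hy')
    rw [eq_mul t ht y hy, S.mul_assoc, S.mul_add_eq, S.mul_eq_add_lam, fixed y hy _ h1,
      swap y hy _ h1]
    exact add_mem _ h1 _ hy
  refine ⟨⟨_, h0, _, hY.1, S.zero_add _⟩, ?_, ?_, mul_mem, ?_⟩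
  · rintro _ ⟨t, ht, y, hy, rfl⟩ _ ⟨s, hs, y', hy', rfl⟩
    rw [S.add_assoc, swap y hy _ ⟨s, hs, y', hy', rfl⟩, ← S.add_assoc, ← S.add_assoc]
    exact add_mem _ (add_mem _ (hadd t ht s hs) _ hy') _ hy
  · rintro _ ⟨t, ht, y, hy, rfl⟩
    rw [hcT y hy t ht, S.neg_add_rev]
    exact add_mem _ (hneg t ht) _ (hY.2.2 _ hy)
  · rintro _ ⟨t, ht, y, hy, rfl⟩
    have h1 : S.inv y = S.neg y := by
      apply S.inv_eq_of_mul_eq_zero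
      rw [S.mul_eq_add_lam, (hc y hy _ (Or.inr (hY.2.2 y hy))).2, S.add_neg]
    rw [eq_mul t ht y hy, S.inv_mul_rev, h1]
    exact mul_mem _ (hinv t ht) _ ⟨_, h0, _, hY.2.2 y hy, S.zero_add _⟩

/-- The set of elements commuting additively with `d` and fixed by `λ_d` is an additive
subgroup. -/
theorem isAddSubgroup_centralized (d : B) :
    S.IsAddSubgroup {u | S.add d u = S.add u d ∧ S.lam d u = u} := by
  let := S.addGroup
  refine ⟨⟨by rw [S.add_zero, S.zero_add], S.lam_zero d⟩, ?_, ?_⟩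
  · rintro a ⟨ha, ha'⟩ b ⟨hb, hb'⟩
    have h1 : AddCommute d a := ha
    have h2 : AddCommute d b := hb
    exact ⟨h1.add_right h2, by rw [S.lam_add, ha', hb']⟩
  · rintro a ⟨ha, ha'⟩
    have h1 : AddCommute d a := ha
    exact ⟨h1.neg_right, by rw [S.lam_neg, ha']⟩

theorem addClosure_centralizes {T D : Set B}
    (h : ∀ d ∈ D, ∀ u ∈ T ∪ D, S.add d u = S.add u d ∧ S.lam d u = u) :
    ∀ y ∈ S.addClosure D, ∀ u ∈ T ∪ S.addClosure D, S.add y u = S.add u y ∧ S.lam y u = u := by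
  have h1 : ∀ d ∈ D, ∀ u ∈ T ∪ S.addClosure D, S.add d u = S.add u d ∧ S.lam d u = u := by
    rintro d hd u (hu | hu)
    · exact h d hd u (Or.inl hu)
    · exact addClosure_subset (isAddSubgroup_centralized d)
        (fun v hv => h d hd v (Or.inr hv)) hu
  have hcl := isAddSubgroup_addClosure (S := S) D
  suffices hs : S.IsAddSubgroup {y | y ∈ S.addClosure D ∧
      ∀ u ∈ T ∪ S.addClosure D, S.add y u = S.add u y ∧ S.lam y u = u} from fun y hy =>
    (addClosure_subset hs (fun d hd => ⟨subset_addClosure D hd, h1 d hd⟩) hy).2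
  let := S.addGroup
  refine ⟨⟨hcl.1, fun u _ => ⟨by rw [S.add_zero, S.zero_add], S.zero_lam u⟩⟩, ?_, ?_⟩
  · rintro a ⟨ha, ha'⟩ b ⟨hb, hb'⟩
    refine ⟨hcl.2.1 a ha b hb, fun u hu => ⟨?_, ?_⟩⟩
    · have h1 : AddCommute a u := (ha' u hu).1
      have h2 : AddCommute b u := (hb' u hu).1
      exact h1.add_left h2
    · have : S.add a b = S.mul a b := by rw [S.mul_eq_add_lam, (ha' b (Or.inr hb)).2]
      rw [this, S.lam_mul, (hb' u hu).2, (ha' u hu).2]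
  · rintro a ⟨ha, ha'⟩
    refine ⟨hcl.2.2 a ha, fun u hu => ⟨?_, ?_⟩⟩
    · have h1 : AddCommute a u := (ha' u hu).1
      exact h1.neg_left
    · have : S.inv a = S.neg a := by
        apply S.inv_eq_of_mul_eq_zero
        rw [S.mul_eq_add_lam, (ha' _ (Or.inr (hcl.2.2 a ha))).2, S.add_neg]
      rw [← this]
      conv_lhs => rw [← (ha' u hu).2]
      exact S.inv_lam_lam a u

theorem lam_mem_addClosure {D : Set B} (t : B) (h : ∀ d ∈ D, S.lam t d ∈ S.addClosure D) :
    ∀ y ∈ S.addClosure D, S.lam t y ∈ S.addClosure D := by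
  have hcl := isAddSubgroup_addClosure (S := S) D
  suffices hs : S.IsAddSubgroup {y | S.lam t y ∈ S.addClosure D} from fun y hy =>
    addClosure_subset hs h hy
  refine ⟨?_, fun a ha b hb => ?_, fun a ha => ?_⟩ <;> simp only [Set.mem_ofPred_eq] at *
  · rw [S.lam_zero]; exact hcl.1
  · rw [S.lam_add]; exact hcl.2.1 _ ha _ hb
  · rw [S.lam_neg]; exact hcl.2.2 _ ha

/-- Additive subgroups of a finitely generated commutative subgroup are finitely generated. -/
theorem exists_finset_addClosure_eq {D K : Set B} (hD : D.Finite)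
    (hcomm : ∀ x ∈ D, ∀ y ∈ D, S.add x y = S.add y x) (hK : S.IsAddSubgroup K)
    (hKD : K ⊆ S.addClosure D) : ∃ R : Finset B, S.addClosure ↑R = K := by
  let := S.addGroup
  let : AddCommGroup (AddSubgroup.closure D) :=
    { (inferInstance : AddGroup (AddSubgroup.closure D)) with
      add_comm := (AddSubgroup.isAddCommutative_closure hcomm).is_comm.comm }
  have hcl : ∀ X : Set B, S.addClosure X = AddSubgroup.closure X := fun X => by
    apply Set.Subset.antisymm
    · exact addClosure_subset ⟨zero_mem _, fun a ha b hb => add_mem ha hb,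
        fun a ha => neg_mem ha⟩ AddSubgroup.subset_closure
    · have hX := isAddSubgroup_addClosure (S := S) X
      let H : AddSubgroup B :=
        { carrier := S.addClosure X
          zero_mem' := hX.1
          add_mem' := fun {a b} ha hb => hX.2.1 a ha b hb
          neg_mem' := fun {a} ha => hX.2.2 a ha }
      exact (AddSubgroup.closure_le H).2 (subset_addClosure X)
  let H : AddSubgroup B :=
    { carrier := K
      zero_mem' := hK.1
      add_mem' := fun {a b} ha hb => hK.2.1 a ha b hb
      neg_mem' := fun {a} ha => hK.2.2 a ha }
  have hH : H ≤ AddSubgroup.closure D := by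
    intro x hx
    have := hKD hx
    rwa [hcl] at this
  have : AddGroup.FG (AddSubgroup.closure D) :=
    (AddGroup.fg_iff_addSubgroup_fg _).2 ⟨hD.toFinset, by rw [hD.coe_toFinset]⟩
  have : Module.Finite ℤ (AddSubgroup.closure D) := Module.Finite.iff_addGroup_fg.2 this
  have hfg : (AddSubgroup.toIntSubmodule (H.addSubgroupOf (AddSubgroup.closure D))).FG :=
    IsNoetherian.noetherian _
  rw [Submodule.fg_iff_addSubgroup_fg, AddSubgroup.toIntSubmodule_toAddSubgroup] at hfg
  obtain ⟨R, hR⟩ := hfg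
  classical
  refine ⟨R.image (AddSubgroup.closure D).subtype, ?_⟩
  rw [hcl, Finset.coe_image, ← AddMonoidHom.map_closure, hR,
    AddSubgroup.addSubgroupOf_map_subtype, inf_eq_left.2 hH]
  rfl

end Commuting

section Socle

variable {B : Type u} {S : SkewBrace B}

theorem isAddSubgroup_soc : S.IsAddSubgroup S.soc := by
  let := S.addGroup
  have mul_eq : ∀ a ∈ S.soc, ∀ b, S.mul a b = S.add a b := fun a ha b => by
    rw [S.mul_eq_add_lam, ha.1]
  refine ⟨⟨S.zero_lam, fun b => by rw [S.add_zero, S.zero_add]⟩, ?_, ?_⟩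
  · intro a ha b hb
    refine ⟨fun c => ?_, fun c => ?_⟩
    · rw [← mul_eq a ha, S.lam_mul, hb.1, ha.1]
    · have h1 : AddCommute a c := ha.2 c
      exact h1.add_left (hb.2 c)
  · intro a ha
    refine ⟨fun c => ?_, fun c => ?_⟩
    · have : S.inv a = S.neg a := S.inv_eq_of_mul_eq_zero (by rw [mul_eq a ha, S.add_neg])
      rw [← this]
      conv_lhs => rw [← ha.1 c]
      exact S.inv_lam_lam a c
    · have h1 : AddCommute a c := ha.2 c
      exact h1.neg_left

theorem lam_mem_soc (b : B) {z : B} (hz : z ∈ S.soc) : S.lam b z ∈ S.soc := by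
  have hcentral : ∀ c, S.add (S.lam b z) c = S.add c (S.lam b z) := fun c => by
    rw [← S.lam_inv_lam b c, ← S.lam_add, hz.2, S.lam_add]
  have hconj : S.lam b z = S.mul b (S.mul z (S.inv b)) := by
    rw [S.mul_eq_add_lam z, hz.1, hz.2, S.mul_add_eq, S.mul_inv, S.zero_add]
  refine ⟨fun c => ?_, hcentral⟩
  rw [hconj, S.lam_mul, S.lam_mul, hz.1, S.lam_inv_lam]

theorem lam_add_soc (u : B) {z : B} (hz : z ∈ S.soc) (c : B) :
    S.lam (S.add u z) c = S.lam u c := by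
  have : S.add u z = S.mul z u := by rw [S.mul_eq_add_lam, hz.1, hz.2]
  rw [this, S.lam_mul, hz.1]

theorem exists_finite_transversal
    (hsoc : (Set.range fun b => S.add b '' S.soc).Finite) :
    ∃ T : Set B, T.Finite ∧ S.zero ∈ T ∧ ∀ b, ∃ t ∈ T, ∃ z ∈ S.soc, b = S.add t z := by
  have : Finite (Set.range fun b => S.add b '' S.soc) := hsoc
  refine ⟨insert S.zero (Set.range (Set.rangeSplitting fun b => S.add b '' S.soc)),
    (Set.finite_range _).insert _, Set.mem_insert _ _, fun b => ?_⟩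
  let c : Set.range fun b => S.add b '' S.soc := ⟨_, b, rfl⟩
  have hb : b ∈ S.add (Set.rangeSplitting _ c) '' S.soc := by
    have h1 := Set.apply_rangeSplitting (fun b => S.add b '' S.soc) c
    have h2 : b ∈ (c : Set B) := ⟨S.zero, isAddSubgroup_soc.1, S.add_zero b⟩
    rw [← h1] at h2
    exact h2
  obtain ⟨z, hz, hb⟩ := hb
  exact ⟨_, Set.mem_insert_of_mem _ ⟨c, rfl⟩, z, hz, hb.symm⟩

theorem soc_finitely_generated (hfg : S.FinitelyGenerated) {T : Set B} (hT : T.Finite)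
    (h0 : S.zero ∈ T) (hcover : ∀ b, ∃ t ∈ T, ∃ z ∈ S.soc, b = S.add t z) :
    ∃ D : Set B, D.Finite ∧ S.addClosure D = S.soc := by
  obtain ⟨X, hX⟩ := hfg
  choose τ hτ c hc hdecomp using hcover
  set E : Set B := ↑X ∪ Set.image2 S.add T T ∪ Set.image2 S.mul T T ∪ S.neg '' T ∪ S.inv '' T
    with hE
  have hEfin : E.Finite := ((((X.finite_toSet).union (hT.image2 _ hT)).union
    (hT.image2 _ hT)).union (hT.image _)).union (hT.image _)
  set D₀ : Set B := c '' E ∪ (T ∩ S.soc) with hD₀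
  have hD₀fin : D₀.Finite := (hEfin.image _).union (hT.inter_of_left _)
  have hD₀soc : D₀ ⊆ S.soc := by
    rintro _ (⟨e, -, rfl⟩ | h)
    · exact hc e
    · exact h.2
  set D : Set B := Set.image2 S.lam T D₀ with hD
  have hD₀D : D₀ ⊆ D := fun d hd => ⟨_, h0, d, hd, S.zero_lam d⟩
  have hDsoc : S.addClosure D ⊆ S.soc := addClosure_subset isAddSubgroup_soc <| by
    rintro _ ⟨t, -, d, hd, rfl⟩
    exact lam_mem_soc t (hD₀soc hd)
  have hmem : ∀ e ∈ E, e ∈ Set.image2 S.add T (S.addClosure D) := fun e he =>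
    ⟨τ e, hτ e, c e, subset_addClosure _ (hD₀D (Or.inl ⟨e, he, rfl⟩)), (hdecomp e).symm⟩
  have hsub : S.IsSub (Set.image2 S.add T (S.addClosure D)) := by
    apply isSub_image2_add (isAddSubgroup_addClosure D)
    · exact fun y hy u _ => ⟨(hDsoc hy).2 u, (hDsoc hy).1 u⟩
    · refine fun t ht => lam_mem_addClosure t ?_
      rintro _ ⟨s, hs, d, hd, rfl⟩
      apply subset_addClosure
      rw [← S.lam_mul, hdecomp (S.mul t s), lam_add_soc _ (hc _)]
      exact ⟨_, hτ _, d, hd, rfl⟩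
    · exact h0
    · exact fun t ht s hs => hmem _ (Or.inl (Or.inl (Or.inl (Or.inr ⟨t, ht, s, hs, rfl⟩))))
    · exact fun t ht => hmem _ (Or.inl (Or.inr ⟨t, ht, rfl⟩))
    · exact fun t ht s hs => hmem _ (Or.inl (Or.inl (Or.inr ⟨t, ht, s, hs, rfl⟩)))
    · exact fun t ht => hmem _ (Or.inr ⟨t, ht, rfl⟩)
  refine ⟨D, hT.image2 _ hD₀fin, hDsoc.antisymm fun z hz => ?_⟩
  have hz' : z ∈ S.subGen ↑X := hX ▸ Set.mem_univ z
  obtain ⟨t, ht, y, hy, rfl⟩ := hz' _ ⟨hsub, fun x hx =>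
    hmem x (Or.inl (Or.inl (Or.inl (Or.inl hx))))⟩
  refine (isAddSubgroup_addClosure D).2.1 _ (subset_addClosure _ (hD₀D (Or.inr ⟨ht, ?_⟩))) _ hy
  have := isAddSubgroup_soc.2.1 _ hz _ (isAddSubgroup_soc.2.2 _ (hDsoc hy))
  rwa [S.add_assoc, S.add_neg, S.add_zero] at this

end Socle

section Presentation

variable {B : Type u} {S : SkewBrace B}

/-- If a finitely generated ideal of a skew brace is contained in the kernel of a homomorphism,
and the kernel modulo that ideal is finitely generated as an additive group, then the kernel is
finitely generated as an ideal. -/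
theorem exists_finset_ker_eq_idealGen {F Q : Type u} {SF : SkewBrace F} {SQ : SkewBrace Q}
    {θ : F → B} {q : F → Q} {R₁ : Set F} (hθ : IsHom SF S θ) (hq : IsHom SF SQ q)
    (hR₁ : R₁.Finite) (hR₁θ : R₁ ⊆ {x | θ x = S.zero})
    (hqI : ∀ a b, q a = q b ↔ SF.add (SF.neg b) a ∈ SF.idealGen R₁)
    {K : Finset Q} (hK : SQ.addClosure ↑K = q '' {x | θ x = S.zero}) :
    ∃ R : Finset F, {x | θ x = S.zero} = SF.idealGen ↑R := by
  classical
  have hKsub : (K : Set Q) ⊆ q '' {x | θ x = S.zero} := hK ▸ subset_addClosure _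
  obtain ⟨R₂, hR₂θ, hR₂K⟩ := Finset.subset_set_image_iff.1 hKsub
  refine ⟨hR₁.toFinset ∪ R₂, Set.Subset.antisymm (fun f hf => ?_) ?_⟩
  · set J := SF.idealGen ↑(hR₁.toFinset ∪ R₂) with hJ
    have hJi : SF.IsIdeal J := isIdeal_idealGen _
    have hRJ : ↑(hR₁.toFinset ∪ R₂) ⊆ J := subset_idealGen _
    rw [Finset.coe_union, hR₁.coe_toFinset, Set.union_subset_iff] at hRJ
    have hKJ : SQ.addClosure ↑K ⊆ q '' J := by
      refine addClosure_subset (hJi.1.image hq) ?_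
      rw [← hR₂K, Finset.coe_image]
      exact Set.image_mono hRJ.2
    rw [hK] at hKJ
    obtain ⟨j, hj, hjf⟩ := hKJ ⟨f, hf, rfl⟩
    have h1 := idealGen_subset hJi hRJ.1 ((hqI f j).1 hjf.symm)
    have h2 := hJi.1.2.1 _ hj _ h1
    rwa [SF.add_neg_cancel_left] at h2
  · refine idealGen_subset hθ.isIdeal_ker ?_
    rw [Finset.coe_union, hR₁.coe_toFinset]
    exact Set.union_subset hR₁θ hR₂θ

theorem finitelyPresented_of_transversal {T D : Set B} (hT : T.Finite) (hD : D.Finite)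
    (hDsoc : S.addClosure D = S.soc)
    (hcover : ∀ b, ∃ t ∈ T, ∃ z ∈ S.soc, b = S.add t z) : S.FinitelyPresented := by
  obtain ⟨m, e, -, he⟩ := (hT.union hD).fin_param
  obtain ⟨θ, ⟨hθ, hθe⟩, -⟩ := isFreeOn_free.{u} m B S e
  set SF := free.{u} m with hSF
  set T' : Set (Quotient (freeSetoid.{u} m)) := insert SF.zero (freeVar '' (e ⁻¹' T)) with hT'
  set D' : Set (Quotient (freeSetoid.{u} m)) := freeVar '' (e ⁻¹' D) with hD'
  have hT'fin : T'.Finite := ((Set.toFinite _).image _).insert _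
  have hD'fin : D'.Finite := (Set.toFinite _).image _
  have hTθ : ∀ t ∈ T, ∃ t' ∈ T', θ t' = t := fun t ht => by
    obtain ⟨i, hi⟩ : t ∈ Set.range e := he ▸ Or.inl ht
    exact ⟨freeVar i, Or.inr ⟨i, by rwa [Set.mem_preimage, hi], rfl⟩, by rw [hθe, hi]⟩
  have hDθ : θ '' D' = D := by
    apply Set.Subset.antisymm
    · rintro _ ⟨_, ⟨i, hi, rfl⟩, rfl⟩
      rw [hθe]; exact hi
    · intro d hd
      obtain ⟨i, hi⟩ : d ∈ Set.range e := he ▸ Or.inr hd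
      exact ⟨freeVar i, ⟨i, by rwa [Set.mem_preimage, hi], rfl⟩, by rw [hθe, hi]⟩
  have hYθ : θ '' SF.addClosure D' = S.soc := by rw [image_addClosure hθ, hDθ, hDsoc]
  have hYsoc : ∀ y ∈ SF.addClosure D', θ y ∈ S.soc := fun y hy => hYθ ▸ ⟨y, hy, rfl⟩
  have hr : ∀ f, ∃ g, θ g = θ f ∧ g ∈ Set.image2 SF.add T' (SF.addClosure D') ∧
      (θ f ∈ S.soc → g ∈ SF.addClosure D') := by
    intro f
    by_cases hf : θ f ∈ S.soc
    · obtain ⟨g, hg, hgf⟩ : θ f ∈ θ '' SF.addClosure D' := hYθ ▸ hf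
      exact ⟨g, hgf, ⟨_, Or.inl rfl, g, hg, SF.zero_add g⟩, fun _ => hg⟩
    · obtain ⟨t, ht, z, hz, htz⟩ := hcover (θ f)
      obtain ⟨t', ht', rfl⟩ := hTθ t ht
      obtain ⟨w, hw, rfl⟩ : z ∈ θ '' SF.addClosure D' := hYθ ▸ hz
      exact ⟨SF.add t' w, by rw [hθ.1, htz], ⟨t', ht', w, hw, rfl⟩, fun h => absurd h hf⟩
  choose r hrθ hrN hrY using hr
  have hsurj : Function.Surjective θ := fun b => by
    obtain ⟨t, ht, z, hz, rfl⟩ := hcover b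
    obtain ⟨t', -, rfl⟩ := hTθ t ht
    obtain ⟨w, -, rfl⟩ : z ∈ θ '' SF.addClosure D' := hYθ ▸ hz
    exact ⟨_, hθ.1 t' w⟩
  set E : Set (Quotient (freeSetoid.{u} m)) := T' ∪ Set.image2 SF.lam T' D' ∪
    Set.image2 SF.add T' T' ∪ Set.image2 SF.mul T' T' ∪ SF.neg '' T' ∪ SF.inv '' T' with hE
  have hEfin : E.Finite := ((((hT'fin.union (hT'fin.image2 _ hD'fin)).union
    (hT'fin.image2 _ hT'fin)).union (hT'fin.image2 _ hT'fin)).union (hT'fin.image _)).union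
    (hT'fin.image _)
  have hUfin := hT'fin.union hD'fin
  set R₁ : Set (Quotient (freeSetoid.{u} m)) := (fun f => SF.add (SF.neg (r f)) f) '' E ∪
    Set.image2 (fun d u => SF.add (SF.neg (SF.add u d)) (SF.add d u)) D' (T' ∪ D') ∪
    Set.image2 (fun d u => SF.add (SF.neg u) (SF.lam d u)) D' (T' ∪ D') with hR₁
  have hR₁fin : R₁.Finite := ((hEfin.image _).union (hD'fin.image2 _ hUfin)).union
    (hD'fin.image2 _ hUfin)
  have hker : ∀ a b, θ a = θ b → θ (SF.add (SF.neg b) a) = S.zero := fun a b h => by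
    rw [hθ.1, hθ.map_neg, h, S.neg_add]
  have hR₁θ : R₁ ⊆ {x | θ x = S.zero} := by
    rintro _ ((⟨f, -, rfl⟩ | ⟨d, hd, u, -, rfl⟩) | ⟨d, hd, u, -, rfl⟩)
    · exact hker _ _ (hrθ f).symm
    · exact hker _ _ (by rw [hθ.1, hθ.1, (hYsoc d (subset_addClosure _ hd)).2])
    · exact hker _ _ (by rw [hθ.map_lam, (hYsoc d (subset_addClosure _ hd)).1])
  obtain ⟨Q, SQ, q, hq, -, hqI⟩ := (isIdeal_idealGen (S := SF) R₁).exists_quotient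
  have hqθ : ∀ a b, q a = q b → θ a = θ b := fun a b h => by
    have h1 := idealGen_subset hθ.isIdeal_ker hR₁θ ((hqI a b).1 h)
    apply S.eq_of_neg_add_eq_zero
    rw [← hθ.map_neg, ← hθ.1]
    exact h1
  have hqr : ∀ f ∈ E, q f = q (r f) := fun f hf =>
    (hqI _ _).2 (subset_idealGen _ (Or.inl (Or.inl ⟨f, hf, rfl⟩)))
  have hqY : q '' SF.addClosure D' = SQ.addClosure (q '' D') := image_addClosure hq D'
  have hqN : ∀ f ∈ E, q f ∈ Set.image2 SQ.add (q '' T') (SQ.addClosure (q '' D')) := by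
    intro f hf
    obtain ⟨t, ht, w, hw, htw⟩ := hrN f
    rw [hqr f hf, ← htw, hq.1, ← hqY]
    exact ⟨_, ⟨t, ht, rfl⟩, _, ⟨w, hw, rfl⟩, rfl⟩
  have hcD : ∀ d ∈ q '' D', ∀ u ∈ q '' T' ∪ q '' D',
      SQ.add d u = SQ.add u d ∧ SQ.lam d u = u := by
    rintro _ ⟨d, hd, rfl⟩ u hu
    rw [← Set.image_union] at hu
    obtain ⟨u, hu, rfl⟩ := hu
    rw [← hq.1, ← hq.1, ← hq.map_lam]
    exact ⟨(hqI _ _).2 (subset_idealGen _ (Or.inl (Or.inr ⟨d, hd, u, hu, rfl⟩))),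
      (hqI _ _).2 (subset_idealGen _ (Or.inr ⟨d, hd, u, hu, rfl⟩))⟩
  have hsub : SQ.IsSub (Set.image2 SQ.add (q '' T') (SQ.addClosure (q '' D'))) := by
    apply isSub_image2_add (isAddSubgroup_addClosure _) (addClosure_centralizes hcD)
    · rintro _ ⟨t, ht, rfl⟩
      refine lam_mem_addClosure _ ?_
      rintro _ ⟨d, hd, rfl⟩
      rw [← hq.map_lam, ← hqY, hqr _ (Or.inl (Or.inl (Or.inl (Or.inl (Or.inr
        ⟨t, ht, d, hd, rfl⟩)))))]
      refine ⟨_, hrY _ ?_, rfl⟩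
      rw [hθ.map_lam]
      exact lam_mem_soc _ (hYsoc d (subset_addClosure _ hd))
    · exact ⟨_, Or.inl rfl, hq.map_zero⟩
    · rintro _ ⟨t, ht, rfl⟩ _ ⟨s, hs, rfl⟩
      rw [← hq.1]
      exact hqN _ (Or.inl (Or.inl (Or.inl (Or.inr ⟨t, ht, s, hs, rfl⟩))))
    · rintro _ ⟨t, ht, rfl⟩
      rw [← hq.map_neg]
      exact hqN _ (Or.inl (Or.inr ⟨t, ht, rfl⟩))
    · rintro _ ⟨t, ht, rfl⟩ _ ⟨s, hs, rfl⟩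
      rw [← hq.2]
      exact hqN _ (Or.inl (Or.inl (Or.inr ⟨t, ht, s, hs, rfl⟩)))
    · rintro _ ⟨t, ht, rfl⟩
      rw [← hq.map_inv]
      exact hqN _ (Or.inr ⟨t, ht, rfl⟩)
  have hall : ∀ f, q f ∈ Set.image2 SQ.add (q '' T') (SQ.addClosure (q '' D')) := by
    refine map_free_mem hq hsub fun i => ?_
    rcases (he ▸ Set.mem_range_self i : e i ∈ T ∪ D) with hi | hi
    · exact ⟨_, ⟨freeVar i, Or.inr ⟨i, hi, rfl⟩, rfl⟩, _, (isAddSubgroup_addClosure _).1,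
        SQ.add_zero _⟩
    · exact ⟨_, ⟨SF.zero, Or.inl rfl, hq.map_zero⟩, _,
        subset_addClosure _ ⟨freeVar i, ⟨i, hi, rfl⟩, rfl⟩, SQ.zero_add _⟩
  have hKY : q '' {x | θ x = S.zero} ⊆ SQ.addClosure (q '' D') := by
    rintro _ ⟨f, hf, rfl⟩
    obtain ⟨_, ⟨t, ht, rfl⟩, y, hy, hty⟩ := hall f
    obtain ⟨w, hw, rfl⟩ : y ∈ q '' SF.addClosure D' := hqY ▸ hy
    have h1 : S.add (θ t) (θ w) = S.zero := by
      rw [← hθ.1, hqθ (SF.add t w) f (by rw [hq.1, hty])]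
      exact hf
    have h2 : θ t ∈ S.soc := by
      rw [← S.neg_neg (θ t), S.neg_eq_of_add_eq_zero h1]
      exact isAddSubgroup_soc.2.2 _ (hYsoc w hw)
    rw [← hty]
    refine (isAddSubgroup_addClosure _).2.1 _ ?_ _ hy
    rw [hqr t (Or.inl (Or.inl (Or.inl (Or.inl (Or.inl ht))))), ← hqY]
    exact ⟨_, hrY t h2, rfl⟩
  obtain ⟨K, hK⟩ := exists_finset_addClosure_eq (hD'fin.image q)
    (fun x hx y hy => (hcD x hx y (Or.inr hy)).1) (hθ.isIdeal_ker.1.image hq) hKY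
  exact ⟨_, SF, m, freeVar, θ, isFreeOn_free m, hθ, hsurj,
    exists_finset_ker_eq_idealGen hθ hq hR₁fin hR₁θ hqI hK⟩

end Presentation

end SkewBrace

/-- **Theorem.** Let `B` be a finitely generated skew brace such that `B/Soc(B)` is
finite (i.e. `Soc(B)` has finitely many cosets in `B`). If the group `(B,∘)` is
virtually abelian, then `B` is finitely presented as a skew brace. -/
theorem finitely_presented_of_finite_over_socle {B : Type u} (S : SkewBrace B)
    (hfg : S.FinitelyGenerated)
    (hsoc : (Set.range fun b => S.add b '' S.soc).Finite)
    (hva : ∃ A : Set B, S.IsMulSubgroup A ∧ (∀ a ∈ A, ∀ b ∈ A, S.mul a b = S.mul b a) ∧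
      (Set.range fun b => S.mul b '' A).Finite) :
    S.FinitelyPresented := by
  obtain ⟨T, hT, h0, hcover⟩ := SkewBrace.exists_finite_transversal hsoc
  obtain ⟨D, hD, hDsoc⟩ := SkewBrace.soc_finitely_generated hfg hT h0 hcover
  exact SkewBrace.finitelyPresented_of_transversal hT hD hDsoc hcover
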